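/- Let $n \ge 2$, let $x, l, h \in \mathbb{R}^n$, let $L = l h^T + h l^T$, and let $P$ be the $2n \times 2n$ block matrix $\begin{pmatrix} A & B \\ B^T & A \end{pmatrix}$ with $a_{ij} = L_{ij}\cos(x_i - x_j)$ and $b_{ij} = L_{ij}\sin(x_i - x_j)$. If $\mathrm{rank}(L) = 2$, then $\mathrm{rank}(P) = 4$. -/

import Mathlib

open Matrix

/-- The rank of a block diagonal matrix with two blocks is the sum of the ranks of the blocks. -/
theorem Matrix.rank_fromBlocks_zero_zero {K l m n o : Type*} [Field K] [Fintype l] [Fintype m]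
    [Finite n] [Finite o] (A : Matrix n l K) (D : Matrix o m K) :
    (fromBlocks A 0 0 D).rank = A.rank + D.rank := by
  have key : (fromBlocks A 0 0 D).mulVecLin =
      (LinearEquiv.sumArrowLequivProdArrow n o K K).symm.toLinearMap ∘ₗ
        (A.mulVecLin.prodMap D.mulVecLin) ∘ₗ
          (LinearEquiv.sumArrowLequivProdArrow l m K K).toLinearMap := by
    refine LinearMap.ext fun v => ?_
    ext (i | i) <;> simp [fromBlocks_mulVec] <;> rfl
  unfold Matrix.rank
  rw [key, LinearMap.range_comp, LinearEquiv.finrank_map_eq,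
    LinearMap.range_comp_of_range_eq_top _ (LinearEquiv.range _), LinearMap.range_prodMap,
    ← Module.finrank_prod]
  exact LinearEquiv.finrank_eq
    { toFun := fun v => (⟨v.1.1, v.2.1⟩, ⟨v.1.2, v.2.2⟩)
      invFun := fun w => ⟨(w.1, w.2), w.1.2, w.2.2⟩
      map_add' := fun _ _ => rfl
      map_smul' := fun _ _ => rfl
      left_inv := fun _ => rfl
      right_inv := fun _ => rfl }

/-- The block rotation matrix with angles `x`. -/
noncomputable def blockRotation {n : Type*} [DecidableEq n] (x : n → ℝ) :
    Matrix (n ⊕ n) (n ⊕ n) ℝ :=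
  fromBlocks (diagonal fun i => Real.cos (x i)) (diagonal fun i => Real.sin (x i))
    (-diagonal fun i => Real.sin (x i)) (diagonal fun i => Real.cos (x i))

theorem isUnit_det_blockRotation {n : Type*} [Fintype n] [DecidableEq n] (x : n → ℝ) :
    IsUnit (blockRotation x).det := by
  refine isUnit_det_of_right_inverse (B := (blockRotation x)ᵀ) ?_
  rw [blockRotation, fromBlocks_transpose, fromBlocks_multiply, ← fromBlocks_one]
  congr 1 <;> ext i j <;> by_cases hij : i = j <;>
    simp [hij, one_apply, ← pow_two (Real.cos _), ← pow_two (Real.sin _), mul_comm]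

theorem fromBlocks_cos_sin_eq_blockRotation_mul {n : Type*} [Fintype n] [DecidableEq n]
    (x : n → ℝ) (L : Matrix n n ℝ) :
    fromBlocks (of fun i j => L i j * Real.cos (x i - x j))
        (of fun i j => L i j * Real.sin (x i - x j))
        (of fun i j => L i j * Real.sin (x j - x i))
        (of fun i j => L i j * Real.cos (x i - x j)) =
      blockRotation x * fromBlocks L 0 0 L * (blockRotation x)ᵀ := by
  rw [blockRotation, fromBlocks_transpose, fromBlocks_multiply, fromBlocks_multiply]
  congr 1 <;> ext i j <;> simp [Real.cos_sub, Real.sin_sub] <;> ring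

theorem rank_gen_trig_eq_four
    (n : ℕ) (hn : 2 ≤ n) (x l h : Fin n → ℝ)
    (L : Matrix (Fin n) (Fin n) ℝ)
    (hL : L = Matrix.of fun i j => l i * h j + h i * l j)
    (A B : Matrix (Fin n) (Fin n) ℝ)
    (hA : A = Matrix.of fun i j => L i j * Real.cos (x i - x j))
    (hB : B = Matrix.of fun i j => L i j * Real.sin (x i - x j))
    (P : Matrix (Fin n ⊕ Fin n) (Fin n ⊕ Fin n) ℝ)
    (hP : P = Matrix.fromBlocks A B Bᵀ A)
    (hrank : L.rank = 2) :
    P.rank = 4 := by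
  have hBT : Bᵀ = of fun i j => L i j * Real.sin (x j - x i) := by
    ext i j
    simp only [hB, hL, transpose_apply, of_apply]
    ring
  have hdet : IsUnit (blockRotation x)ᵀ.det := by
    rw [det_transpose]
    exact isUnit_det_blockRotation x
  rw [hP, hBT, hA, hB, fromBlocks_cos_sin_eq_blockRotation_mul,
    rank_mul_eq_left_of_isUnit_det _ _ hdet,
    rank_mul_eq_right_of_isUnit_det _ _ (isUnit_det_blockRotation x),
    rank_fromBlocks_zero_zero, hrank]
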